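/- Let Q be a compact metric space, c : Q × Q → ℝ continuous, nonnegative with c(x,x) = 0, p₀ : Q → [0,+∞] proper, f a finite nonnegative Borel measure on Q, and v₀(x) = inf_{y∈Q}(c(x,y) + p₀(y)). Then the maximization problem max { I(v) : v ∈ ℬ } admits a solution, i.e. there exists a c-concave function v* with 0 ≤ v* ≤ v₀ such that I(v) ≤ I(v*) for every c-concave v with 0 ≤ v ≤ v₀, where I(v) = ∫_Q [ v(x) − min_{y ∈ ∂^c v(x)} c(x,y) ] df(x). -/

import Mathlib

open Filter Set MeasureTheory
open scoped ENNReal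

noncomputable section

/-- A function `v : Q → ℝ` is `c`-concave if there is an upper semicontinuous
`u : Q → ℝ` with `v x = ⨅ y, (c x y - u y)`. -/
def CConcave {Q : Type*} [TopologicalSpace Q] (c : Q → Q → ℝ) (v : Q → ℝ) : Prop :=
  ∃ u : Q → ℝ, UpperSemicontinuous u ∧ ∀ x, v x = ⨅ y, (c x y - u y)

/-- The `c`-transform `v^c (y) = ⨅ x, (c x y - v x)`. -/
def ctransform {Q : Type*} (c : Q → Q → ℝ) (v : Q → ℝ) (y : Q) : ℝ :=
  ⨅ x, (c x y - v x)

/-- The `c`-superdifferential `∂^c v (x) = {y | v x + v^c y = c x y}`. -/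
def csuperdiff {Q : Type*} (c : Q → Q → ℝ) (v : Q → ℝ) (x : Q) : Set Q :=
  {y | v x + ctransform c v y = c x y}

/-- The profit functional `I(v) = ∫ (v x - min_{y ∈ ∂^c v(x)} c x y) df`. -/
def Ifun {Q : Type*} [MeasurableSpace Q] (f : Measure Q) (c : Q → Q → ℝ)
    (v : Q → ℝ) : ℝ :=
  ∫ x, (v x - sInf ((fun y => c x y) '' csuperdiff c v x)) ∂f

open scoped BoundedContinuousFunction

section Infima

variable {Q Z : Type*} [TopologicalSpace Q] [CompactSpace Q] [TopologicalSpace Z]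

theorem continuous_iInf_of_compactSpace {F : Z → Q → ℝ}
    (hF : Continuous fun z : Z × Q => F z.1 z.2) : Continuous fun z => ⨅ x, F z x := by
  have h := isCompact_univ.continuous_sInf (f := F) (K := univ) hF
  simpa only [image_univ, sInf_range] using h

theorem Continuous.bddBelow_range_of_compactSpace {g : Q → ℝ} (hg : Continuous g) :
    BddBelow (range g) :=
  (isCompact_range hg).bddBelow

theorem Continuous.exists_eq_iInf [Nonempty Q] {g : Q → ℝ} (hg : Continuous g) :
    ∃ x, g x = ⨅ y, g y :=
  (isCompact_range hg).sInf_mem (range_nonempty g)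

end Infima

section CTransform

variable {Q : Type*} [MetricSpace Q] [CompactSpace Q] {c : Q → Q → ℝ}

theorem bddBelow_range_sub_of_upperSemicontinuous
    (hc : Continuous fun z : Q × Q => c z.1 z.2) {u : Q → ℝ} (hu : UpperSemicontinuous u)
    (x : Q) : BddBelow (range fun y => c x y - u y) := by
  obtain ⟨M, hM⟩ :=
    UpperSemicontinuousOn.bddAbove_of_isCompact isCompact_univ (hu.upperSemicontinuousOn univ)
  obtain ⟨m, hm⟩ := (show Continuous fun y => c x y by fun_prop).bddBelow_range_of_compactSpace
  refine ⟨m - M, ?_⟩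
  rintro _ ⟨y, rfl⟩
  exact sub_le_sub (hm ⟨y, rfl⟩) (hM ⟨y, mem_univ y, rfl⟩)

/-- The family `x ↦ c x ·` of continuous functions on `Q`. -/
def costCurry (hc : Continuous fun z : Q × Q => c z.1 z.2) : C(Q, C(Q, ℝ)) :=
  ContinuousMap.curry ⟨fun z : Q × Q => c z.1 z.2, hc⟩

theorem CConcave.le_add_dist [Nonempty Q] (hc : Continuous fun z : Q × Q => c z.1 z.2) {v : Q → ℝ}
    (hv : CConcave c v) (x x' : Q) : v x ≤ v x' + dist (costCurry hc x) (costCurry hc x') := by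
  obtain ⟨u, hu, h⟩ := hv
  rw [← sub_le_iff_le_add, h x']
  refine le_ciInf fun y => ?_
  have h₁ : v x ≤ c x y - u y :=
    (h x).trans_le (ciInf_le (bddBelow_range_sub_of_upperSemicontinuous hc hu x) y)
  have h₂ : |c x y - c x' y| ≤ dist (costCurry hc x) (costCurry hc x') :=
    ContinuousMap.dist_apply_le_dist (f := costCurry hc x) (g := costCurry hc x') y
  linarith [le_abs_self (c x y - c x' y)]

theorem equicontinuous_of_cconcave [Nonempty Q]
    (hc : Continuous fun z : Q × Q => c z.1 z.2) {ι : Type*} {F : ι → Q → ℝ}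
    (hF : ∀ i, CConcave c (F i)) : Equicontinuous F := by
  intro x
  rw [Metric.equicontinuousAt_iff_right]
  intro ε hε
  filter_upwards [Metric.continuousAt_iff'.1 (costCurry hc).continuous.continuousAt ε hε]
    with x' hx' i
  rw [Real.dist_eq, abs_lt]
  have h₁ := (hF i).le_add_dist hc x x'
  have h₂ := (hF i).le_add_dist hc x' x
  rw [dist_comm] at h₁
  constructor <;> linarith

theorem CConcave.continuous [Nonempty Q] (hc : Continuous fun z : Q × Q => c z.1 z.2) {v : Q → ℝ}
    (hv : CConcave c v) : Continuous v :=
  (equicontinuous_of_cconcave hc (F := fun _ : Unit => v) fun _ => hv).continuous ()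

theorem continuous_ctransform_uncurry (hc : Continuous fun z : Q × Q => c z.1 z.2) :
    Continuous fun z : (Q →ᵇ ℝ) × Q => ctransform c z.1 z.2 := by
  refine continuous_iInf_of_compactSpace (F := fun (z : (Q →ᵇ ℝ) × Q) x => c x z.2 - z.1 x) ?_
  refine (hc.comp (continuous_snd.prodMk (continuous_snd.comp continuous_fst))).sub ?_
  exact ContinuousEval.continuous_eval.comp
    ((continuous_fst.comp continuous_fst).prodMk continuous_snd)

theorem continuous_bitransform_uncurry (hc : Continuous fun z : Q × Q => c z.1 z.2) :
    Continuous fun z : (Q →ᵇ ℝ) × Q => ⨅ y, (c z.2 y - ctransform c z.1 y) := by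
  refine continuous_iInf_of_compactSpace
    (F := fun (z : (Q →ᵇ ℝ) × Q) y => c z.2 y - ctransform c z.1 y) ?_
  refine (hc.comp ((continuous_snd.comp continuous_fst).prodMk continuous_snd)).sub ?_
  exact (continuous_ctransform_uncurry hc).comp
    ((continuous_fst.comp continuous_fst).prodMk continuous_snd)

theorem continuous_ctransform (hc : Continuous fun z : Q × Q => c z.1 z.2) (v : Q →ᵇ ℝ) :
    Continuous (ctransform c v) :=
  (continuous_ctransform_uncurry hc).comp (Continuous.prodMk_right v)

theorem isClosed_csuperdiff_graph (hc : Continuous fun z : Q × Q => c z.1 z.2) :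
    IsClosed {z : ((Q →ᵇ ℝ) × Q) × Q | z.2 ∈ csuperdiff c z.1.1 z.1.2} := by
  refine isClosed_eq (Continuous.add ?_ ?_) ?_
  · exact ContinuousEval.continuous_eval.comp continuous_fst
  · exact (continuous_ctransform_uncurry hc).comp
      ((continuous_fst.comp continuous_fst).prodMk continuous_snd)
  · exact hc.comp ((continuous_snd.comp continuous_fst).prodMk continuous_snd)

variable [Nonempty Q]

/-- A continuous function is `c`-concave iff it equals its double `c`-transform. -/
theorem cconcave_iff_eq_bitransform (hc : Continuous fun z : Q × Q => c z.1 z.2)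
    (v : Q →ᵇ ℝ) : CConcave c v ↔ ∀ x, v x = ⨅ y, (c x y - ctransform c v y) := by
  refine ⟨?_, fun h => ⟨_, (continuous_ctransform hc v).upperSemicontinuous, h⟩⟩
  rintro ⟨u, hu, h⟩ x
  have hb (y : Q) : BddBelow (range fun x => c x y - v x) :=
    Continuous.bddBelow_range_of_compactSpace
      ((hc.comp (Continuous.prodMk_left y)).sub v.continuous)
  have hb' := bddBelow_range_sub_of_upperSemicontinuous hc
    (continuous_ctransform hc v).upperSemicontinuous x
  apply le_antisymm
  · refine le_ciInf fun y => ?_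
    have : ctransform c v y ≤ c x y - v x := ciInf_le (hb y) x
    linarith
  · rw [h x]
    refine ciInf_mono hb' fun y => sub_le_sub_left ?_ _
    refine le_ciInf fun x' => ?_
    have : v x' ≤ c x' y - u y :=
      (h x').trans_le (ciInf_le (bddBelow_range_sub_of_upperSemicontinuous hc hu x') y)
    linarith

theorem csuperdiff_nonempty (hc : Continuous fun z : Q × Q => c z.1 z.2) {v : Q →ᵇ ℝ}
    (hv : CConcave c v) (x : Q) : (csuperdiff c v x).Nonempty := by
  have hcont : Continuous fun y => c x y - ctransform c v y :=
    (hc.comp (Continuous.prodMk_right x)).sub (continuous_ctransform hc v)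
  obtain ⟨y, hy⟩ := hcont.exists_eq_iInf
  refine ⟨y, ?_⟩
  have := (cconcave_iff_eq_bitransform hc v).1 hv x
  change v x + ctransform c v y = c x y
  linarith

theorem exists_mem_csuperdiff_eq_sInf (hc : Continuous fun z : Q × Q => c z.1 z.2)
    {v : Q →ᵇ ℝ} (hv : CConcave c v) (x : Q) :
    ∃ y ∈ csuperdiff c v x, c x y = sInf ((fun y => c x y) '' csuperdiff c v x) := by
  have hcl : IsClosed (csuperdiff c v x) :=
    (isClosed_csuperdiff_graph hc).preimage (Continuous.prodMk_right (v, x))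
  exact (hcl.isCompact.image (hc.comp (Continuous.prodMk_right x))).sInf_mem
    ((csuperdiff_nonempty hc hv x).image _)

/-- The minimal transport cost over the superdifferential is jointly lower semicontinuous. -/
theorem lowerSemicontinuous_sInf_csuperdiff (hc : Continuous fun z : Q × Q => c z.1 z.2)
    (hc0 : ∀ x y, 0 ≤ c x y) {Z : Type*} [TopologicalSpace Z] {φ : Z → Q →ᵇ ℝ} {ξ : Z → Q}
    (hφ : Continuous φ) (hξ : Continuous ξ) (hcc : ∀ z, CConcave c (φ z)) :
    LowerSemicontinuous fun z => sInf ((fun y => c (ξ z) y) '' csuperdiff c (φ z) (ξ z)) := by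
  rw [lowerSemicontinuous_iff_isClosed_preimage]
  intro a
  have hcl : IsClosed {w : Z × Q | w.2 ∈ csuperdiff c (φ w.1) (ξ w.1) ∧ c (ξ w.1) w.2 ≤ a} := by
    refine IsClosed.inter ?_ ?_
    · exact (isClosed_csuperdiff_graph hc).preimage
        (f := fun w : Z × Q => ((φ w.1, ξ w.1), w.2)) (by fun_prop)
    · exact isClosed_le (hc.comp ((hξ.comp continuous_fst).prodMk continuous_snd))
        continuous_const
  convert! isClosedMap_fst_of_compactSpace _ hcl using 1
  ext z
  simp only [mem_preimage, mem_Iic, mem_image, mem_ofPred_eq, Prod.exists, exists_and_right,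
    exists_eq_right]
  constructor
  · intro h
    obtain ⟨y, hy, hyx⟩ := exists_mem_csuperdiff_eq_sInf hc (hcc z) (ξ z)
    exact ⟨y, hy, hyx.trans_le h⟩
  · rintro ⟨y, hy, hya⟩
    refine le_trans (csInf_le ⟨0, ?_⟩ (mem_image_of_mem (fun y => c (ξ z) y) hy)) hya
    rintro _ ⟨y, -, rfl⟩
    exact hc0 (ξ z) y

end CTransform

theorem lowerSemicontinuous_lintegral_of_uncurry {X Q : Type*} [TopologicalSpace X]
    [FirstCountableTopology X] [TopologicalSpace Q] [MeasurableSpace Q] [BorelSpace Q]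
    (f : Measure Q) {F : X → Q → ℝ≥0∞} (hF : LowerSemicontinuous fun z : X × Q => F z.1 z.2) :
    LowerSemicontinuous fun v => ∫⁻ x, F v x ∂f := by
  rw [lowerSemicontinuous_iff_le_liminf]
  intro v
  have hmeas (w : X) : Measurable (F w) :=
    LowerSemicontinuous.measurable (hF.comp (g := fun x => (w, x)) (by fun_prop))
  refine le_trans (lintegral_mono fun x => ?_) (lintegral_liminf_le hmeas)
  exact (hF.comp (g := fun w => (w, x)) (by fun_prop)).le_liminf v

theorem exists_nonneg_bound_of_toReal_iInf {Q : Type*} [MetricSpace Q] [CompactSpace Q]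
    {c : Q → Q → ℝ} (hc : Continuous fun z : Q × Q => c z.1 z.2) (hc0 : ∀ x y, 0 ≤ c x y)
    {p₀ : Q → ℝ≥0∞} (hp₀ : ∃ y, p₀ y ≠ ⊤) {v₀ : Q → ℝ}
    (hv₀ : ∀ x, v₀ x = (⨅ y, ((c x y : EReal) + (p₀ y : EReal))).toReal) :
    (∀ x, 0 ≤ v₀ x) ∧ ∃ M, ∀ x, v₀ x ≤ M := by
  have hnn (x : Q) : 0 ≤ ⨅ y, ((c x y : EReal) + (p₀ y : EReal)) :=
    le_iInf fun y => add_nonneg (EReal.coe_nonneg.2 (hc0 x y)) (EReal.coe_ennreal_nonneg _)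
  refine ⟨fun x => (hv₀ x).symm ▸ EReal.toReal_nonneg (hnn x), ?_⟩
  obtain ⟨y, hy⟩ := hp₀
  obtain ⟨C, hC⟩ := (isCompact_range (hc.comp (Continuous.prodMk_left y))).bddAbove
  refine ⟨C + (p₀ y).toReal, fun x => ?_⟩
  rw [hv₀ x]
  have h : ⨅ y, ((c x y : EReal) + (p₀ y : EReal)) ≤ ((C + (p₀ y).toReal : ℝ) : EReal) := by
    refine (iInf_le _ y).trans ?_
    rw [EReal.coe_add, EReal.coe_ennreal_toReal hy]
    gcongr
    exact hC ⟨x, rfl⟩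
  exact EReal.toReal_le_toReal h ((EReal.bot_lt_zero.trans_le (hnn x)).ne') (EReal.coe_ne_top _)

section Maximizer

variable {Q : Type*} [MetricSpace Q] [CompactSpace Q] [Nonempty Q] {c : Q → Q → ℝ}

theorem isCompact_cconcave_between (hc : Continuous fun z : Q × Q => c z.1 z.2)
    {v₀ : Q → ℝ} {M : ℝ} (hM : ∀ x, v₀ x ≤ M) :
    IsCompact {v : Q →ᵇ ℝ | CConcave c v ∧ ∀ x, 0 ≤ v x ∧ v x ≤ v₀ x} := by
  refine BoundedContinuousFunction.arzela_ascoli₂ (Icc 0 M) isCompact_Icc _ ?_ ?_ ?_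
  · have h : {v : Q →ᵇ ℝ | CConcave c v ∧ ∀ x, 0 ≤ v x ∧ v x ≤ v₀ x} =
        ⋂ x, {v : Q →ᵇ ℝ | v x = ⨅ y, (c x y - ctransform c v y)} ∩
          {v | 0 ≤ v x} ∩ {v | v x ≤ v₀ x} := by
      ext v
      simp only [cconcave_iff_eq_bitransform hc, mem_iInter, mem_inter_iff, mem_ofPred_eq,
        ← forall_and, and_assoc]
    rw [h]
    refine isClosed_iInter fun x => IsClosed.inter (IsClosed.inter ?_ ?_) ?_
    · exact isClosed_eq (continuous_eval_const x)
        ((continuous_bitransform_uncurry hc).comp (Continuous.prodMk_left x))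
    · exact isClosed_le continuous_const (continuous_eval_const x)
    · exact isClosed_le (continuous_eval_const x) continuous_const
  · exact fun v x hv => ⟨(hv.2 x).1, (hv.2 x).2.trans (hM x)⟩
  · exact equicontinuous_of_cconcave hc fun v => v.2.1

theorem integrable_sInf_csuperdiff [MeasurableSpace Q] [BorelSpace Q]
    (hc : Continuous fun z : Q × Q => c z.1 z.2) (hc0 : ∀ x y, 0 ≤ c x y)
    (f : Measure Q) [IsFiniteMeasure f] {v : Q →ᵇ ℝ} (hv : CConcave c v) :
    Integrable (fun x => sInf ((fun y => c x y) '' csuperdiff c v x)) f := by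
  have hgm := (lowerSemicontinuous_sInf_csuperdiff hc hc0 (φ := fun _ : Q => v)
    continuous_const continuous_id fun _ => hv).measurable
  obtain ⟨C, hC⟩ := (isCompact_range hc).bddAbove
  refine Integrable.of_bound hgm.aestronglyMeasurable C (.of_forall fun x => ?_)
  obtain ⟨y, -, hy⟩ := exists_mem_csuperdiff_eq_sInf hc hv x
  rw [← hy, Real.norm_of_nonneg (hc0 x y)]
  exact hC ⟨(x, y), rfl⟩

theorem Ifun_eq_sub_toReal_lintegral [MeasurableSpace Q] [BorelSpace Q]
    (hc : Continuous fun z : Q × Q => c z.1 z.2) (hc0 : ∀ x y, 0 ≤ c x y)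
    (f : Measure Q) [IsFiniteMeasure f] {v : Q →ᵇ ℝ} (hv : CConcave c v)
    {M : ℝ} (hM : ∀ x, v x ≤ M) :
    ∫⁻ x, ENNReal.ofReal (M - v x + sInf ((fun y => c x y) '' csuperdiff c v x)) ∂f ≠ ⊤ ∧
    Ifun f c v = f.real univ * M -
      (∫⁻ x, ENNReal.ofReal
        (M - v x + sInf ((fun y => c x y) '' csuperdiff c v x)) ∂f).toReal := by
  have hgi := integrable_sInf_csuperdiff hc hc0 f hv
  have hvi : Integrable v f := v.integrable f
  have hMv : Integrable (fun x => M - v x) f := (integrable_const M).sub hvi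
  have hh : Integrable
      (fun x => M - v x + sInf ((fun y => c x y) '' csuperdiff c v x)) f := hMv.add hgi
  have hnn (x : Q) : 0 ≤ M - v x + sInf ((fun y => c x y) '' csuperdiff c v x) := by
    refine add_nonneg (sub_nonneg.2 (hM x)) (Real.sInf_nonneg ?_)
    rintro _ ⟨y, -, rfl⟩
    exact hc0 x y
  refine ⟨hh.lintegral_lt_top.ne, ?_⟩
  rw [← integral_eq_lintegral_of_nonneg_ae (.of_forall hnn) hh.aestronglyMeasurable,
    integral_add hMv hgi, integral_sub (integrable_const M) hvi,
    integral_const, smul_eq_mul, Ifun, integral_sub hvi hgi]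
  ring

end Maximizer

/-- The problem `max { I(v) : v ∈ ℬ }` admits a solution. -/
theorem exists_maximizer_I
    {Q : Type*} [MetricSpace Q] [CompactSpace Q] [Nonempty Q]
    [MeasurableSpace Q] [BorelSpace Q]
    (c : Q → Q → ℝ) (hc : Continuous fun z : Q × Q => c z.1 z.2)
    (hc0 : ∀ x y, 0 ≤ c x y) (hcd : ∀ x, c x x = 0)
    (p₀ : Q → ℝ≥0∞) (hp₀ : ∃ y, p₀ y ≠ ⊤)
    (f : Measure Q) [IsFiniteMeasure f]
    (v₀ : Q → ℝ)
    (hv₀ : ∀ x, v₀ x = (⨅ y, ((c x y : EReal) + (p₀ y : EReal))).toReal) :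
    ∃ vstar : Q → ℝ, CConcave c vstar ∧ (∀ x, 0 ≤ vstar x ∧ vstar x ≤ v₀ x) ∧
      ∀ v : Q → ℝ, CConcave c v → (∀ x, 0 ≤ v x ∧ v x ≤ v₀ x) →
        Ifun f c v ≤ Ifun f c vstar := by
  obtain ⟨hv₀nn, M, hM⟩ := exists_nonneg_bound_of_toReal_iInf hc hc0 hp₀ hv₀
  set K : Set (Q →ᵇ ℝ) := {v | CConcave c v ∧ ∀ x, 0 ≤ v x ∧ v x ≤ v₀ x} with hK
  have hKc : CompactSpace K := isCompact_iff_compactSpace.1 (isCompact_cconcave_between hc hM)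
  have hne : Nonempty K := by
    refine ⟨0, ⟨0, upperSemicontinuous_const, fun x => ?_⟩, fun x => ⟨le_rfl, hv₀nn x⟩⟩
    have hb : BddBelow (range fun y => c x y - (0 : Q → ℝ) y) :=
      ⟨0, by rintro _ ⟨y, rfl⟩; simpa using hc0 x y⟩
    refine le_antisymm (le_ciInf fun y => by simpa using hc0 x y) ?_
    simpa [hcd] using ciInf_le hb x
  set F : K → Q → ℝ≥0∞ := fun v x => ENNReal.ofReal
    (M - (v : Q →ᵇ ℝ) x + sInf ((fun y => c x y) '' csuperdiff c (v : Q →ᵇ ℝ) x)) with hF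
  have hFlsc : LowerSemicontinuous fun z : K × Q => F z.1 z.2 := by
    refine ENNReal.continuous_ofReal.comp_lowerSemicontinuous
      (f := fun z : K × Q => M - (z.1 : Q →ᵇ ℝ) z.2 +
        sInf ((fun y => c z.2 y) '' csuperdiff c (z.1 : Q →ᵇ ℝ) z.2)) ?_
      fun a b h => ENNReal.ofReal_le_ofReal h
    refine LowerSemicontinuous.add (Continuous.lowerSemicontinuous ?_)
      (lowerSemicontinuous_sInf_csuperdiff hc hc0
        (continuous_subtype_val.comp continuous_fst) continuous_snd fun z => z.1.2.1)
    exact continuous_const.sub (ContinuousEval.continuous_eval.comp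
      ((continuous_subtype_val.comp continuous_fst).prodMk continuous_snd))
  obtain ⟨w, -, hw⟩ := LowerSemicontinuousOn.exists_isMinOn univ_nonempty isCompact_univ
    ((lowerSemicontinuous_lintegral_of_uncurry f hFlsc).lowerSemicontinuousOn univ)
  refine ⟨(w : Q →ᵇ ℝ), w.2.1, w.2.2, fun v hv hvb => ?_⟩
  set v' : Q →ᵇ ℝ := BoundedContinuousFunction.mkOfCompact ⟨v, hv.continuous hc⟩
  have hmin : ∫⁻ x, F w x ∂f ≤ ∫⁻ x, F ⟨v', hv, hvb⟩ x ∂f := hw (mem_univ _)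
  obtain ⟨-, hIw⟩ :=
    Ifun_eq_sub_toReal_lintegral hc hc0 f w.2.1 fun x => (w.2.2 x).2.trans (hM x)
  obtain ⟨hfin, hIv⟩ :=
    Ifun_eq_sub_toReal_lintegral hc hc0 f (v := v') hv fun x => (hvb x).2.trans (hM x)
  change Ifun f c v' ≤ _
  rw [hIw, hIv]
  exact sub_le_sub_left (ENNReal.toReal_mono hfin hmin) _
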